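/- Fix m, n ∈ ℕ, p ∈ (0,2], an isotropic Borel measure μ on the unit sphere S^{m−1}, and let X = X_p(μ) = (ℝ^m, ‖·‖_{p,μ}). For a unit vector a ∈ ℝ^n let G_a be a standard Gaussian random vector on the subspace H_a of ℝ^{mn}. Then for every λ ∈ (0,∞) and unit vectors θ = (θ_1,…,θ_n), φ = (φ_1,…,φ_n) in ℝ^n, if (θ_1²,…,θ_n²) is majorized by (φ_1²,…,φ_n²), then E[exp(−λ ‖G_θ‖_{ℓ_p^n(X)}^p)] ≤ E[exp(−λ ‖G_φ‖_{ℓ_p^n(X)}^p)]. -/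

import Mathlib

open MeasureTheory Real Filter
open scoped ENNReal

noncomputable section

/-- `N` is a quasi-norm on `ℝ^m`. -/
def IsQuasiNorm (m : ℕ) (N : (Fin m → ℝ) → ℝ) : Prop :=
  (∀ x, 0 ≤ N x) ∧ (∀ x, N x = 0 ↔ x = 0) ∧
    (∀ (a : ℝ) (x : Fin m → ℝ), N (a • x) = |a| * N x) ∧
    ∃ C : ℝ, 1 ≤ C ∧ ∀ x y, N (x + y) ≤ C * (N x + N y)

/-- `X = (ℝ^m, N)` admits an isometric embedding into some `L_p(μ)` space:
there are a measure space `(Ω, μ)` and a linear map `T : ℝ^m → L_p(μ)` with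
`‖T x‖_{L_p(μ)} = N x` for every `x`. -/
def EmbedsIntoLp (m : ℕ) (p : ℝ) (N : (Fin m → ℝ) → ℝ) : Prop :=
  ∃ (Ω : Type) (_ : MeasurableSpace Ω) (μ : Measure Ω) (T : (Fin m → ℝ) →ₗ[ℝ] (Ω → ℝ)),
    (∀ x, Integrable (fun ω => |T x ω| ^ p) μ) ∧
    ∀ x, (∫ ω, |T x ω| ^ p ∂μ) ^ (1 / p) = N x

/-- `α` is majorized by `β`: for every `k`, the sum of the `k` largest entries of `α` is at
most that of `β` (expressed via finite subsets: the sum of the `k` largest entries is the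
maximum of `∑ i ∈ A, · i` over sets `A` of cardinality `k`), and the total sums agree. -/
def IsMajorizedBy {n : ℕ} (α β : Fin n → ℝ) : Prop :=
  (∀ A : Finset (Fin n), ∃ B : Finset (Fin n), B.card = A.card ∧ ∑ i ∈ A, α i ≤ ∑ i ∈ B, β i) ∧
    ∑ i, α i = ∑ i, β i

/-- The unit ball `B_p^n(X)` of `ℓ_p^n(X)` for `X = (ℝ^m, N)` and `0 < p < ∞`. -/
def lpBall (m n : ℕ) (p : ℝ) (N : (Fin m → ℝ) → ℝ) : Set (Fin n × Fin m → ℝ) :=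
  {x | ∑ i : Fin n, N (fun j => x (i, j)) ^ p ≤ 1}

/-- The block hyperplane `H_θ = {(x_1,…,x_n) ∈ (ℝ^m)^n : ∑ θ_i x_i = 0}`. -/
def blockHyp (m n : ℕ) (θ : Fin n → ℝ) : Set (Fin n × Fin m → ℝ) :=
  {x | ∀ j : Fin m, ∑ i : Fin n, θ i * x (i, j) = 0}

/-- `ι` is a linear isometric parametrization (w.r.t. the Euclidean structures) of the
subspace `H` of `ℝ^{mn} = (ℝ^m)^n` by `ℝ^d`; for `A ⊆ H`, `volume (⇑ι ⁻¹' A)` is then the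
`d`-dimensional Lebesgue measure of `A` inside `H`. -/
def IsEuclParam (m n d : ℕ) (ι : (Fin d → ℝ) →ₗ[ℝ] (Fin n × Fin m → ℝ))
    (H : Set (Fin n × Fin m → ℝ)) : Prop :=
  (∀ y, ∑ c, ι y c ^ 2 = ∑ i, y i ^ 2) ∧ Set.range ⇑ι = H

/-- The norm of `X_p(μ)` for a Borel measure `μ` on the unit sphere `S^{m-1}`:
`‖x‖_{p,μ} = (∫_{S^{m-1}} |⟨x,u⟩|^p dμ(u))^{1/p}`. -/
def lewisNorm (m : ℕ) (p : ℝ) (μ : Measure (Metric.sphere (0 : EuclideanSpace ℝ (Fin m)) 1))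
    (x : Fin m → ℝ) : ℝ :=
  (∫ u, |∑ k, x k * (u : EuclideanSpace ℝ (Fin m)) k| ^ p ∂μ) ^ (1 / p)

/-- `μ` is an isotropic measure on the sphere `S^{m-1}`:
`‖x‖₂² = ∫_{S^{m-1}} ⟨x,u⟩² dμ(u)` for all `x ∈ ℝ^m`. -/
def IsIsotropic (m : ℕ) (μ : Measure (Metric.sphere (0 : EuclideanSpace ℝ (Fin m)) 1)) : Prop :=
  ∀ x : Fin m → ℝ, ∑ k, x k ^ 2 = ∫ u, (∑ k, x k * (u : EuclideanSpace ℝ (Fin m)) k) ^ 2 ∂μ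

lemma sum_mul_ge_of_monotone {n : ℕ} (c x : Fin (n + 1) → ℝ) (hc : Monotone c)
    (hx : ∀ k, 0 ≤ ∑ i ∈ Finset.Ici k, x i) : c 0 * ∑ i, x i ≤ ∑ i, c i * x i := by
  induction n with
  | zero => simp
  | succ n ih =>
    have hs : ∀ k : Fin (n + 1), ∑ i ∈ Finset.Ici k, x i.succ = ∑ i ∈ Finset.Ici k.succ, x i := by
      intro k
      rw [← Fin.map_succEmb_Ici, Finset.sum_map]
      rfl
    have h := ih (fun i => c i.succ) (fun i => x i.succ)
      (fun i j hij => hc (Fin.succ_le_succ_iff.2 hij)) (fun k => by rw [hs]; exact hx _)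
    rw [Fin.sum_univ_succ, Fin.sum_univ_succ (fun i => c i * x i)]
    have h0 : 0 ≤ ∑ i : Fin (n + 1), x i.succ := by
      have := hx (Fin.succ 0)
      rw [← hs] at this
      convert this using 2
      ext i; simp
    have h1 : c 0 ≤ c (Fin.succ 0) := hc (Fin.zero_le _)
    nlinarith

lemma sum_le_sum_Ici_of_monotone {n : ℕ} {b : Fin n → ℝ} (hb : Monotone b) (k : Fin n)
    (B : Finset (Fin n)) (hB : B.card = (Finset.Ici k).card) :
    ∑ i ∈ B, b i ≤ ∑ i ∈ Finset.Ici k, b i := by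
  have h : ∑ i ∈ B, (b i - b k) ≤ ∑ i ∈ Finset.Ici k, (b i - b k) := by
    calc ∑ i ∈ B, (b i - b k) ≤ ∑ i ∈ B, max (b i - b k) 0 :=
          Finset.sum_le_sum fun i _ => le_max_left _ _
      _ ≤ ∑ i, max (b i - b k) 0 :=
          Finset.sum_le_sum_of_subset_of_nonneg (Finset.subset_univ _) fun _ _ _ => le_max_right _ _
      _ = ∑ i ∈ Finset.Ici k, max (b i - b k) 0 := by
          symm
          apply Finset.sum_subset (Finset.subset_univ _)
          intro i _ hi
          rw [Finset.mem_Ici, not_le] at hi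
          exact max_eq_right (sub_nonpos.2 (hb hi.le))
      _ = ∑ i ∈ Finset.Ici k, (b i - b k) :=
          Finset.sum_congr rfl fun i hi => max_eq_left (sub_nonneg.2 (hb (Finset.mem_Ici.1 hi)))
  simp only [Finset.sum_sub_distrib, Finset.sum_const, hB] at h
  linarith

/-- Karamata's inequality. -/
lemma IsMajorizedBy.sum_convex_le {n : ℕ} {α β : Fin n → ℝ} (hmaj : IsMajorizedBy α β)
    {h : ℝ → ℝ} (hh : ConvexOn ℝ Set.univ h) : ∑ i, h (α i) ≤ ∑ i, h (β i) := by
  rcases n with _ | n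
  · simp
  set d : ℝ → ℝ := fun x => derivWithin h (Set.Ioi x) x
  have hd : Monotone d := by
    have := hh.monotoneOn_rightDeriv
    rw [interior_univ] at this
    exact monotoneOn_univ.1 this
  have hsupp : ∀ x y, d x * (y - x) ≤ h y - h x := by
    intro x y
    have hx : x ∈ interior (Set.univ : Set ℝ) := by simp
    have hy : y ∈ interior (Set.univ : Set ℝ) := by simp
    rcases lt_trichotomy x y with hxy | rfl | hxy
    · have := hh.rightDeriv_le_slope_of_mem_interior hx (Set.mem_univ y) hxy
      rw [slope_def_field, le_div_iff₀ (by linarith)] at this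
      exact this
    · simp
    · have h1 := hh.slope_le_leftDeriv_of_mem_interior (Set.mem_univ y) hx hxy
      have h2 := hh.leftDeriv_le_rightDeriv_of_mem_interior hx
      have h3 := h1.trans h2
      rw [slope_def_field, div_le_iff₀ (by linarith)] at h3
      change _ ≤ d x * _ at h3
      linarith
  set σ := Tuple.sort α
  set τ := Tuple.sort β
  have hσ : Monotone (α ∘ σ) := Tuple.monotone_sort α
  have hτ : Monotone (β ∘ τ) := Tuple.monotone_sort β
  have hsum : ∑ i, (β (τ i) - α (σ i)) = 0 := by
    rw [Finset.sum_sub_distrib, Equiv.sum_comp τ β, Equiv.sum_comp σ α, hmaj.2, sub_self]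
  have key := sum_mul_ge_of_monotone (fun i => d (α (σ i))) (fun i => β (τ i) - α (σ i))
    (hd.comp hσ) (by
      intro k
      rw [Finset.sum_sub_distrib, sub_nonneg]
      obtain ⟨B, hB, hle⟩ := hmaj.1 ((Finset.Ici k).map σ.toEmbedding)
      rw [Finset.sum_map] at hle
      refine hle.trans ?_
      have := sum_le_sum_Ici_of_monotone hτ k (B.map τ.symm.toEmbedding) (by simpa using hB)
      simpa [Finset.sum_map] using this)
  rw [hsum, mul_zero] at key
  rw [← Equiv.sum_comp σ (fun i => h (α i)), ← Equiv.sum_comp τ (fun i => h (β i)), ← sub_nonneg,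
    ← Finset.sum_sub_distrib]
  exact key.trans (Finset.sum_le_sum fun i _ => hsupp _ _)

open ProbabilityTheory

/-- The standard Gaussian measure on `ι → ℝ`. -/
abbrev stdGaussianPi (ι : Type*) [Fintype ι] : Measure (ι → ℝ) :=
  Measure.pi fun _ : ι => gaussianReal 0 1

section Gaussian

variable {ι : Type*} [Fintype ι]

lemma integral_cexp_stdGaussianPi (w : ι → ℝ) :
    ∫ y, Complex.exp (((∑ i, y i * w i : ℝ) : ℂ) * Complex.I) ∂stdGaussianPi ι =
      (Real.exp (-(∑ i, w i ^ 2) / 2) : ℂ) := by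
  have h : ∀ y : ι → ℝ, Complex.exp (((∑ i, y i * w i : ℝ) : ℂ) * Complex.I) =
      ∏ i, Complex.exp (w i * y i * Complex.I) := by
    intro y
    rw [← Complex.exp_sum]
    push_cast
    rw [Finset.sum_mul]
    congr 1
    exact Finset.sum_congr rfl fun i _ => by ring
  simp_rw [h]
  rw [integral_fintype_prod_eq_prod (fun i (t : ℝ) => Complex.exp (w i * t * Complex.I))]
  simp_rw [← charFun_apply_real, charFun_gaussianReal]
  rw [← Complex.exp_sum, Complex.ofReal_exp]
  congr 1
  push_cast
  rw [← Finset.sum_neg_distrib, Finset.sum_div]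
  exact Finset.sum_congr rfl fun i _ => by ring

lemma exp_sum_mul (w y : ι → ℝ) :
    Real.exp (∑ i, y i * w i) = ∏ i, Real.exp (w i * y i) := by
  rw [← Real.exp_sum]
  simp_rw [mul_comm]

lemma integrable_exp_stdGaussianPi (w : ι → ℝ) :
    Integrable (fun y => Real.exp (∑ i, y i * w i)) (stdGaussianPi ι) := by
  simp_rw [exp_sum_mul]
  exact Integrable.fintype_prod (f := fun i (t : ℝ) => Real.exp (w i * t))
    fun i => integrable_exp_mul_gaussianReal _

lemma integral_exp_stdGaussianPi (w : ι → ℝ) :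
    ∫ y, Real.exp (∑ i, y i * w i) ∂stdGaussianPi ι = Real.exp ((∑ i, w i ^ 2) / 2) := by
  simp_rw [exp_sum_mul]
  rw [integral_fintype_prod_eq_prod (fun i (t : ℝ) => Real.exp (w i * t))]
  have : ∀ i, ∫ t, Real.exp (w i * t) ∂gaussianReal 0 1 = Real.exp (w i ^ 2 / 2) := by
    intro i
    have := congrFun (mgf_id_gaussianReal (μ := 0) (v := 1)) (w i)
    simpa [mgf] using this
  simp_rw [this]
  rw [← Real.exp_sum, Finset.sum_div]

lemma stdGaussianPi_eq_withDensity :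
    stdGaussianPi ι =
      volume.withDensity fun y => ENNReal.ofReal (∏ i, gaussianPDFReal 0 1 (y i)) := by
  refine Measure.pi_eq fun s hs => ?_
  rw [withDensity_apply _ (MeasurableSet.univ_pi hs), volume_pi, Measure.restrict_pi_pi,
    ← ofReal_integral_eq_lintegral_ofReal
      (Integrable.fintype_prod fun i => (integrable_gaussianPDFReal 0 1).restrict)
      (ae_of_all _ fun y => Finset.prod_nonneg fun i _ => gaussianPDFReal_nonneg _ _ _),
    integral_fintype_prod_eq_prod, ENNReal.ofReal_prod_of_nonneg
      fun i _ => integral_nonneg fun y => gaussianPDFReal_nonneg _ _ _]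
  refine Finset.prod_congr rfl fun i _ => ?_
  rw [gaussianReal_apply_eq_integral _ one_ne_zero]

lemma integral_stdGaussianPi (F : (ι → ℝ) → ℝ) :
    ∫ y, F y ∂stdGaussianPi ι = (∏ _i : ι, (√(2 * π))⁻¹) *
      ∫ y, Real.exp (-(∑ i, y i ^ 2) / 2) * F y := by
  have hm : Measurable fun y : ι → ℝ => ∏ i, gaussianPDFReal 0 1 (y i) := by fun_prop
  rw [stdGaussianPi_eq_withDensity, integral_withDensity_eq_integral_toReal_smul (by fun_prop)
    (ae_of_all _ fun _ => ENNReal.ofReal_lt_top), ← integral_const_mul]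
  congr 1 with y
  rw [ENNReal.toReal_ofReal (Finset.prod_nonneg fun i _ => gaussianPDFReal_nonneg _ _ _),
    smul_eq_mul, ← mul_assoc]
  simp only [gaussianPDFReal, Finset.prod_mul_distrib, ← Real.exp_sum]
  simp [Finset.sum_div, Finset.sum_neg_distrib, neg_div]

/-- Completing the square in a Gaussian integral. -/
lemma exists_integral_exp_eq {κ : Type*} [Fintype κ]
    (D : Matrix κ ι ℝ) (z : κ → ℝ) :
    ∃ c : ℝ, 0 ≤ c ∧ ∀ s : ℝ,
      ∫ ξ, Real.exp (-(∑ k, (D.mulVec ξ) k ^ 2) / 2 + s * ∑ k, (D.mulVec ξ) k * z k)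
          ∂stdGaussianPi ι =
        Real.exp (s ^ 2 * c) * ∫ ξ, Real.exp (-(∑ k, (D.mulVec ξ) k ^ 2) / 2)
          ∂stdGaussianPi ι := by
  classical
  have hpd : (1 + D.transpose * D).PosDef := by
    have := Matrix.posSemidef_conjTranspose_mul_self D
    rw [Matrix.conjTranspose_eq_transpose_of_trivial] at this
    exact Matrix.PosDef.one.add_posSemidef this
  obtain ⟨a, ha⟩ : ∃ a, (1 + D.transpose * D).mulVec a = D.transpose.mulVec z :=
    ⟨(1 + D.transpose * D)⁻¹.mulVec (D.transpose.mulVec z), by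
      rw [Matrix.mulVec_mulVec, Matrix.mul_nonsing_inv _ ((Matrix.isUnit_iff_isUnit_det _).1 hpd.isUnit),
        Matrix.one_mulVec]⟩
  have hB : ∀ ξ : ι → ℝ, ∑ i, ξ i * a i + ∑ k, D.mulVec ξ k * D.mulVec a k =
      ∑ k, D.mulVec ξ k * z k := by
    intro ξ
    have := congrArg (fun v => ξ ⬝ᵥ v) ha
    simp only [Matrix.add_mulVec, Matrix.one_mulVec, dotProduct_add, ← Matrix.mulVec_mulVec,
      Matrix.mulVec_transpose] at this
    rw [dotProduct_comm ξ (Matrix.vecMul _ D), dotProduct_comm ξ (Matrix.vecMul _ D),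
      ← Matrix.dotProduct_mulVec, ← Matrix.dotProduct_mulVec] at this
    simp only [dotProduct] at this
    simp_rw [mul_comm (D.mulVec ξ _)]
    exact this
  refine ⟨(∑ i, a i ^ 2 + ∑ k, D.mulVec a k ^ 2) / 2, by positivity, fun s => ?_⟩
  rw [integral_stdGaussianPi, integral_stdGaussianPi, mul_left_comm]
  congr 1
  rw [← integral_const_mul, ← integral_add_right_eq_self _ (s • a)]
  congr 1 with ξ
  rw [← Real.exp_add, ← Real.exp_add, ← Real.exp_add]
  congr 1
  have h1 := hB ξ
  have h2 := hB a
  have e1 : ∑ i, (ξ + s • a) i ^ 2 = ∑ i, ξ i ^ 2 + 2 * s * ∑ i, ξ i * a i + s ^ 2 * ∑ i, a i ^ 2 := by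
    simp only [Finset.mul_sum, ← Finset.sum_add_distrib, Pi.add_apply, Pi.smul_apply, smul_eq_mul]
    exact Finset.sum_congr rfl fun i _ => by ring
  have e2 : ∑ k, D.mulVec (ξ + s • a) k ^ 2 = ∑ k, D.mulVec ξ k ^ 2 +
      2 * s * ∑ k, D.mulVec ξ k * D.mulVec a k + s ^ 2 * ∑ k, D.mulVec a k ^ 2 := by
    simp only [Finset.mul_sum, ← Finset.sum_add_distrib, Matrix.mulVec_add, Matrix.mulVec_smul,
      Pi.add_apply, Pi.smul_apply, smul_eq_mul]
    exact Finset.sum_congr rfl fun i _ => by ring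
  have e3 : ∑ k, D.mulVec (ξ + s • a) k * z k = ∑ k, D.mulVec ξ k * z k +
      s * ∑ k, D.mulVec a k * z k := by
    simp only [Finset.mul_sum, ← Finset.sum_add_distrib, Matrix.mulVec_add, Matrix.mulVec_smul,
      Pi.add_apply, Pi.smul_apply, smul_eq_mul]
    exact Finset.sum_congr rfl fun i _ => by ring
  rw [e1, e2, e3, ← h1, ← h2]
  simp_rw [← pow_two]
  ring

end Gaussian

section Sections

variable {m n d : ℕ} {θ : Fin n → ℝ} {ι : (Fin d → ℝ) →ₗ[ℝ] (Fin n × Fin m → ℝ)}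

lemma IsEuclParam.sum_mul {H : Set (Fin n × Fin m → ℝ)} (hι : IsEuclParam m n d ι H)
    (y w : Fin d → ℝ) : ∑ c, ι y c * ι w c = ∑ i, y i * w i := by
  have h := hι.1 (y + w)
  simp only [map_add, Pi.add_apply, add_sq, Finset.sum_add_distrib, hι.1] at h
  simp only [mul_assoc, ← Finset.mul_sum] at h
  linarith

/-- The adjoint of the parametrization of `H_θ`, and the norm of the projection onto `H_θ`. -/
lemma IsEuclParam.exists_adjoint (hθ : ∑ i, θ i ^ 2 = 1)
    (hι : IsEuclParam m n d ι (blockHyp m n θ)) (W : Fin n × Fin m → ℝ) :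
    ∃ w : Fin d → ℝ, (∀ y, ∑ c, ι y c * W c = ∑ i, y i * w i) ∧
      ∑ i, w i ^ 2 = ∑ c, W c ^ 2 - ∑ j, (∑ i, θ i * W (i, j)) ^ 2 := by
  set T : Fin m → ℝ := fun j => ∑ i, θ i * W (i, j)
  have hmem : (fun c : Fin n × Fin m => W c - θ c.1 * T c.2) ∈ blockHyp m n θ := by
    intro j
    have : ∀ i, θ i * (W (i, j) - θ i * T j) = θ i * W (i, j) - θ i ^ 2 * T j := fun i => by ring
    change ∑ i, θ i * (W (i, j) - θ i * T j) = 0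
    simp only [this, Finset.sum_sub_distrib, ← Finset.sum_mul, hθ, one_mul]
    exact sub_self _
  rw [← hι.2] at hmem
  obtain ⟨w, hw⟩ := hmem
  refine ⟨w, fun y => ?_, ?_⟩
  · have hy : ι y ∈ blockHyp m n θ := hι.2 ▸ Set.mem_range_self y
    have h0 : ∑ c, ι y c * (θ c.1 * T c.2) = 0 := by
      rw [Fintype.sum_prod_type_right]
      refine Finset.sum_eq_zero fun j _ => ?_
      have : ∀ i, ι y (i, j) * (θ i * T j) = θ i * ι y (i, j) * T j := fun i => by ring
      simp only [this, ← Finset.sum_mul, hy j, zero_mul]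
    rw [← hι.sum_mul, hw, ← sub_zero (∑ c, ι y c * W c), ← h0, ← Finset.sum_sub_distrib]
    exact Finset.sum_congr rfl fun c _ => by ring
  · rw [← hι.1, hw, Fintype.sum_prod_type_right, Fintype.sum_prod_type_right,
      ← Finset.sum_sub_distrib]
    refine Finset.sum_congr rfl fun j _ => ?_
    have : ∀ i, (W (i, j) - θ i * T j) ^ 2 =
        W (i, j) ^ 2 - 2 * T j * (θ i * W (i, j)) + T j ^ 2 * θ i ^ 2 := fun i => by ring
    simp only [this, Finset.sum_add_distrib, Finset.sum_sub_distrib, ← Finset.mul_sum, hθ]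
    change _ - 2 * T j * T j + _ = _ - T j ^ 2
    ring

lemma IsEuclParam.integral_cexp (hθ : ∑ i, θ i ^ 2 = 1)
    (hι : IsEuclParam m n d ι (blockHyp m n θ)) (W : Fin n × Fin m → ℝ) :
    ∫ y, Complex.exp (((∑ c, ι y c * W c : ℝ) : ℂ) * Complex.I) ∂stdGaussianPi (Fin d) =
      ((∫ z, Real.exp (-(∑ c, W c ^ 2) / 2 + ∑ j, z j * ∑ i, θ i * W (i, j))
        ∂stdGaussianPi (Fin m) : ℝ) : ℂ) := by
  obtain ⟨w, hw1, hw2⟩ := hι.exists_adjoint hθ W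
  simp_rw [hw1, Real.exp_add, integral_const_mul]
  rw [integral_cexp_stdGaussianPi, integral_exp_stdGaussianPi, hw2, ← Real.exp_add]
  congr 2
  ring

lemma IsEuclParam.integral_exp_le_one (hθ : ∑ i, θ i ^ 2 = 1)
    (hι : IsEuclParam m n d ι (blockHyp m n θ)) (W : Fin n × Fin m → ℝ) :
    ∫ z, Real.exp (-(∑ c, W c ^ 2) / 2 + ∑ j, z j * ∑ i, θ i * W (i, j))
        ∂stdGaussianPi (Fin m) ≤ 1 := by
  obtain ⟨w, hw1, hw2⟩ := hι.exists_adjoint hθ W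
  simp_rw [Real.exp_add, integral_const_mul]
  rw [integral_exp_stdGaussianPi, ← Real.exp_add, Real.exp_le_one_iff]
  have : 0 ≤ ∑ i, w i ^ 2 := by positivity
  linarith

variable {S : Type*} [MeasurableSpace S]

/-- The transform whose products over the coordinates of `θ` represent Gaussian integrals over
the block hyperplane `H_θ`. -/
def sectionTransform (τ : Measure S) (V : S → Fin m → ℝ) (s : ℝ) (z : Fin m → ℝ) : ℝ :=
  ∫ ω, Real.exp (-(∑ j, V ω j ^ 2) / 2 + s * ∑ j, V ω j * z j) ∂τ

/-- Fourier representation of Gaussian integrals over a block hyperplane. -/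
lemma IsEuclParam.integral_prod_eq (hθ : ∑ i, θ i ^ 2 = 1)
    (hι : IsEuclParam m n d ι (blockHyp m n θ)) (τ : Measure S) [IsFiniteMeasure τ]
    {V : S → Fin m → ℝ} (hV : Measurable V) {f : (Fin m → ℝ) → ℝ}
    (hf : ∀ x, (f x : ℂ) = ∫ ω, Complex.exp (((∑ j, x j * V ω j : ℝ) : ℂ) * Complex.I) ∂τ) :
    Integrable (fun z => ∏ i, sectionTransform τ V (θ i) z) (stdGaussianPi (Fin m)) ∧
    ∫ y, ∏ i, f (fun j => ι y (i, j)) ∂stdGaussianPi (Fin d) =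
      ∫ z, ∏ i, sectionTransform τ V (θ i) z ∂stdGaussianPi (Fin m) := by
  set τn : Measure (Fin n → S) := Measure.pi fun _ => τ
  set W : (Fin n → S) → Fin n × Fin m → ℝ := fun s c => V (s c.1) c.2 with hW
  have hWm : Measurable W := by
    rw [measurable_pi_iff]
    exact fun c => (measurable_pi_apply _).comp (hV.comp (measurable_pi_apply _))
  have hWc : ∀ c, Measurable fun s => W s c := fun c => (measurable_pi_apply c).comp hWm
  set G : (Fin m → ℝ) × (Fin n → S) → ℝ := fun q =>
    Real.exp (-(∑ c, W q.2 c ^ 2) / 2 + ∑ j, q.1 j * ∑ i, θ i * W q.2 (i, j)) with hG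
  have hGm : Measurable G := by
    have : ∀ c, Measurable fun q : (Fin m → ℝ) × (Fin n → S) => W q.2 c :=
      fun c => (hWc c).comp measurable_snd
    fun_prop
  have hGi : Integrable G ((stdGaussianPi (Fin m)).prod τn) := by
    rw [integrable_prod_iff' hGm.aestronglyMeasurable]
    refine ⟨ae_of_all _ fun s => ?_, ?_⟩
    · simp only [hG, Real.exp_add]
      exact (integrable_exp_stdGaussianPi _).const_mul _
    · refine Integrable.of_bound (C := 1)
        (hGm.norm.aestronglyMeasurable.prod_swap.integral_prod_right') (ae_of_all _ fun s => ?_)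
      rw [Real.norm_of_nonneg (integral_nonneg fun _ => norm_nonneg _)]
      simp only [hG, Real.norm_of_nonneg (Real.exp_nonneg _)]
      exact hι.integral_exp_le_one hθ (W s)
  have hinner : ∀ z, ∫ s, G (z, s) ∂τn = ∏ i, sectionTransform τ V (θ i) z := by
    intro z
    have : ∀ s, G (z, s) =
        ∏ i, Real.exp (-(∑ j, V (s i) j ^ 2) / 2 + θ i * ∑ j, V (s i) j * z j) := by
      intro s
      simp only [hG, hW]
      rw [← Real.exp_sum, Finset.sum_add_distrib, Fintype.sum_prod_type, ← Finset.sum_div,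
        Finset.sum_neg_distrib]
      congr 2
      simp only [Finset.mul_sum]
      rw [Finset.sum_comm]
      exact Finset.sum_congr rfl fun i _ => Finset.sum_congr rfl fun j _ => by ring
    simp_rw [this]
    exact integral_fintype_prod_eq_prod (fun i (ω : S) =>
      Real.exp (-(∑ j, V ω j ^ 2) / 2 + θ i * ∑ j, V ω j * z j))
  refine ⟨by simpa only [hinner] using hGi.integral_prod_left, ?_⟩
  have hE : ∀ y, ((∏ i, f (fun j => ι y (i, j)) : ℝ) : ℂ) =
      ∫ s, Complex.exp (((∑ c, ι y c * W s c : ℝ) : ℂ) * Complex.I) ∂τn := by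
    intro y
    push_cast
    simp_rw [hf]
    rw [← integral_fintype_prod_eq_prod]
    congr 1 with s
    rw [← Complex.exp_sum, ← Finset.sum_mul]
    simp [hW, Fintype.sum_prod_type]
  have hint : Integrable (fun q : (Fin d → ℝ) × (Fin n → S) =>
      Complex.exp (((∑ c, ι q.1 c * W q.2 c : ℝ) : ℂ) * Complex.I))
      ((stdGaussianPi (Fin d)).prod τn) := by
    refine Integrable.of_bound (C := 1) (Measurable.aestronglyMeasurable ?_)
      (ae_of_all _ fun q => (Complex.norm_exp_ofReal_mul_I _).le)
    have h1 : ∀ c, Measurable fun q : (Fin d → ℝ) × (Fin n → S) => W q.2 c :=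
      fun c => (hWc c).comp measurable_snd
    have h2 : ∀ c, Measurable fun q : (Fin d → ℝ) × (Fin n → S) => ι q.1 c :=
      fun c => ((continuous_apply c).comp ι.continuous_of_finiteDimensional).measurable.comp
        measurable_fst
    exact Complex.measurable_exp.comp ((Complex.measurable_ofReal.comp
      (Finset.measurable_sum _ fun c _ => (h2 c).mul (h1 c))).mul_const _)
  apply Complex.ofReal_injective
  rw [← integral_complex_ofReal]
  simp_rw [hE]
  rw [integral_integral_swap hint]
  simp_rw [hι.integral_cexp hθ]
  rw [integral_complex_ofReal]
  congr 1
  exact (integral_integral_swap (f := fun s z => G (z, s)) hGi.swap).trans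
    (integral_congr_ae (ae_of_all _ hinner))

end Sections

/-- The logarithm of `t ↦ ∫ C exp (t c)` is convex. -/
lemma convexOn_log_integral_mul_exp {Ω : Type*} [MeasurableSpace Ω] {ν : Measure Ω}
    {C c : Ω → ℝ} (hC : ∀ ω, 0 < C ω) (hCm : Measurable C) (hc : Measurable c)
    (hint : ∀ t, Integrable (fun ω => C ω * Real.exp (t * c ω)) ν)
    (hpos : ∀ t, 0 < ∫ ω, C ω * Real.exp (t * c ω) ∂ν) :
    ConvexOn ℝ Set.univ fun t => Real.log (∫ ω, C ω * Real.exp (t * c ω) ∂ν) := by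
  have hnn : ∀ t ω, 0 ≤ C ω * Real.exp (t * c ω) := fun t ω =>
    mul_nonneg (hC ω).le (Real.exp_nonneg _)
  have hL : ∀ t, ENNReal.ofReal (∫ ω, C ω * Real.exp (t * c ω) ∂ν) =
      ∫⁻ ω, ENNReal.ofReal (C ω * Real.exp (t * c ω)) ∂ν := fun t =>
    ofReal_integral_eq_lintegral_ofReal (hint t) (ae_of_all _ (hnn t))
  refine ⟨convex_univ, fun t _ s _ a b ha hb hab => ?_⟩
  simp only [smul_eq_mul]
  rw [← Real.log_rpow (hpos t), ← Real.log_rpow (hpos s),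
    ← Real.log_mul (Real.rpow_pos_of_pos (hpos t) _).ne' (Real.rpow_pos_of_pos (hpos s) _).ne']
  refine Real.log_le_log (hpos _) ?_
  rw [← ENNReal.ofReal_le_ofReal_iff (by have := hpos t; have := hpos s; positivity), hL,
    ENNReal.ofReal_mul (by have := hpos t; positivity),
    ← ENNReal.ofReal_rpow_of_nonneg (hpos t).le ha, ← ENNReal.ofReal_rpow_of_nonneg (hpos s).le hb,
    hL, hL]
  refine le_trans (le_of_eq ?_) (ENNReal.lintegral_mul_norm_pow_le
    (Measurable.aemeasurable (by fun_prop)) (Measurable.aemeasurable (by fun_prop)) ha hb hab)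
  refine lintegral_congr fun ω => ?_
  rw [ENNReal.ofReal_rpow_of_nonneg (hnn _ _) ha, ENNReal.ofReal_rpow_of_nonneg (hnn _ _) hb,
    ← ENNReal.ofReal_mul (Real.rpow_nonneg (hnn _ _) _),
    Real.mul_rpow (hC ω).le (Real.exp_nonneg _), Real.mul_rpow (hC ω).le (Real.exp_nonneg _),
    ← Real.exp_mul, ← Real.exp_mul]
  congr 1
  calc C ω * Real.exp ((a * t + b * s) * c ω)
      = C ω ^ (a + b) * Real.exp (t * c ω * a + s * c ω * b) := by
        rw [hab, Real.rpow_one]; ring_nf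
    _ = _ := by rw [Real.rpow_add (hC ω), Real.exp_add]; ring

section Mixture

variable {m n d N : ℕ} {Ω : Type*} [MeasurableSpace Ω] {ν : Measure Ω}
  {D : Ω → Matrix (Fin m) (Fin N) ℝ}

lemma measurable_mulVec (hD : ∀ j k, Measurable fun ω => D ω j k) :
    Measurable fun q : Ω × (Fin N → ℝ) => (D q.1).mulVec q.2 := by
  rw [measurable_pi_iff]
  intro j
  simp only [Matrix.mulVec, dotProduct]
  exact Finset.measurable_sum _ fun k _ => ((hD j k).comp measurable_fst).mul
    ((measurable_pi_apply k).comp measurable_snd)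

lemma neg_sum_sq_add_le (s : ℝ) (v z : Fin m → ℝ) :
    -(∑ j, v j ^ 2) / 2 + s * ∑ j, v j * z j ≤ s ^ 2 * (∑ j, z j ^ 2) / 2 := by
  have h : 0 ≤ ∑ j, (v j - s * z j) ^ 2 := by positivity
  have e : ∑ j, (v j - s * z j) ^ 2 =
      ∑ j, v j ^ 2 - 2 * (s * ∑ j, v j * z j) + s ^ 2 * ∑ j, z j ^ 2 := by
    simp only [Finset.mul_sum, ← Finset.sum_add_distrib, ← Finset.sum_sub_distrib]
    exact Finset.sum_congr rfl fun i _ => by ring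
  linarith

/-- For a mixture of centered Gaussians, the transform is log-convex in `s ^ 2`. -/
lemma exists_convexOn_sectionTransform [IsFiniteMeasure ν] (hν : ν ≠ 0)
    (hD : ∀ j k, Measurable fun ω => D ω j k) (z : Fin m → ℝ) :
    ∃ h : ℝ → ℝ, ConvexOn ℝ Set.univ h ∧ ∀ s,
      sectionTransform (ν.prod (stdGaussianPi (Fin N))) (fun q => (D q.1).mulVec q.2) s z =
        Real.exp (h (s ^ 2)) := by
  set F : ℝ → Ω × (Fin N → ℝ) → ℝ := fun s q =>
    Real.exp (-(∑ j, (D q.1).mulVec q.2 j ^ 2) / 2 + s * ∑ j, (D q.1).mulVec q.2 j * z j) with hF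
  have hFm : ∀ s, Measurable (F s) := by
    intro s
    have := measurable_mulVec hD
    have h' : ∀ j, Measurable fun q : Ω × (Fin N → ℝ) => (D q.1).mulVec q.2 j :=
      fun j => (measurable_pi_apply j).comp this
    fun_prop
  have hFb : ∀ s q, ‖F s q‖ ≤ Real.exp (s ^ 2 * (∑ j, z j ^ 2) / 2) := fun s q => by
    rw [Real.norm_of_nonneg (Real.exp_nonneg _)]
    exact Real.exp_le_exp.2 (neg_sum_sq_add_le _ _ _)
  have hFi : ∀ s, Integrable (F s) (ν.prod (stdGaussianPi (Fin N))) := fun s =>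
    .of_bound (hFm s).aestronglyMeasurable _ (ae_of_all _ (hFb s))
  set E : ℝ → Ω → ℝ := fun s ω => ∫ ξ, F s (ω, ξ) ∂stdGaussianPi (Fin N) with hE
  have hEm : ∀ s, Measurable (E s) := fun s =>
    (hFm s).stronglyMeasurable.integral_prod_right'.measurable
  have hsec : ∀ s ω, Integrable (fun ξ => F s (ω, ξ)) (stdGaussianPi (Fin N)) := fun s ω =>
    .of_bound ((hFm s).comp measurable_prodMk_left).aestronglyMeasurable _
      (ae_of_all _ fun ξ => hFb s _)
  have hEpos : ∀ s ω, 0 < E s ω := fun s ω => by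
    refine (integral_pos_iff_support_of_nonneg (fun _ => Real.exp_nonneg _) (hsec s ω)).2 ?_
    have : Function.support (fun ξ => F s (ω, ξ)) = Set.univ :=
      Set.eq_univ_of_forall fun ξ => (Real.exp_pos _).ne'
    rw [this]; simp
  have hEle : ∀ s ω, E s ω ≤ Real.exp (s ^ 2 * (∑ j, z j ^ 2) / 2) := fun s ω => by
    refine (integral_mono (hsec s ω) (integrable_const _)
      fun ξ => (le_abs_self _).trans (hFb s (ω, ξ))).trans ?_
    simp
  have hex : ∀ ω, ∃ c : ℝ, 0 ≤ c ∧ ∀ s, E s ω = Real.exp (s ^ 2 * c) * E 0 ω := by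
    intro ω
    obtain ⟨c, hc0, hc⟩ := exists_integral_exp_eq (D ω) z
    exact ⟨c, hc0, fun s => by simpa [hE, hF] using hc s⟩
  choose c hc0 hc using hex
  have hcm : Measurable c := by
    have : c = fun ω => Real.log (E 1 ω / E 0 ω) := by
      ext ω
      rw [hc ω 1, mul_div_cancel_right₀ _ (hEpos 0 ω).ne', Real.log_exp]
      ring
    rw [this]
    exact Real.measurable_log.comp ((hEm 1).div (hEm 0))
  have hint : ∀ t, Integrable (fun ω => E 0 ω * Real.exp (t * c ω)) ν := by
    intro t
    refine .of_bound (C := Real.exp (√(max t 0) ^ 2 * (∑ j, z j ^ 2) / 2))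
      ((hEm 0).mul (by fun_prop)).aestronglyMeasurable
      (ae_of_all _ fun ω => ?_)
    rw [Real.norm_of_nonneg (mul_nonneg (hEpos 0 ω).le (Real.exp_nonneg _))]
    refine le_trans ?_ (hEle _ ω)
    rw [hc ω √(max t 0), mul_comm, Real.sq_sqrt (le_max_right _ _)]
    have := hEpos 0 ω
    have := hc0 ω
    gcongr
    exact le_max_left _ _
  have hpos : ∀ t, 0 < ∫ ω, E 0 ω * Real.exp (t * c ω) ∂ν := by
    intro t
    refine (integral_pos_iff_support_of_nonneg
      (fun ω => mul_nonneg (hEpos 0 ω).le (Real.exp_nonneg _)) (hint t)).2 ?_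
    have : Function.support (fun ω => E 0 ω * Real.exp (t * c ω)) = Set.univ :=
      Set.eq_univ_of_forall fun ω => (mul_pos (hEpos 0 ω) (Real.exp_pos _)).ne'
    rw [this]
    exact Measure.measure_univ_pos.2 hν
  refine ⟨_, convexOn_log_integral_mul_exp (hEpos 0) (hEm 0) hcm hint hpos, fun s => ?_⟩
  rw [Real.exp_log (hpos _)]
  change ∫ q, F s q ∂_ = _
  rw [integral_prod _ (hFi s)]
  refine integral_congr_ae (ae_of_all _ fun ω => ?_)
  change E s ω = _
  rw [hc, mul_comm]

/-- The function obtained by mixing the Gaussians `x ↦ exp (-‖x ᵥ* D ω‖² / 2)`. -/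
def gaussianMixture (ν : Measure Ω) (D : Ω → Matrix (Fin m) (Fin N) ℝ) (x : Fin m → ℝ) : ℝ :=
  ∫ ω, Real.exp (-(∑ k, Matrix.vecMul x (D ω) k ^ 2) / 2) ∂ν

lemma gaussianMixture_eq_integral_cexp [IsFiniteMeasure ν]
    (hD : ∀ j k, Measurable fun ω => D ω j k) (x : Fin m → ℝ) :
    (gaussianMixture ν D x : ℂ) =
      ∫ q, Complex.exp (((∑ j, x j * (D q.1).mulVec q.2 j : ℝ) : ℂ) * Complex.I)
        ∂(ν.prod (stdGaussianPi (Fin N))) := by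
  have h' : ∀ j, Measurable fun q : Ω × (Fin N → ℝ) => (D q.1).mulVec q.2 j :=
    fun j => (measurable_pi_apply j).comp (measurable_mulVec hD)
  have hi : Integrable (fun q : Ω × (Fin N → ℝ) =>
      Complex.exp (((∑ j, x j * (D q.1).mulVec q.2 j : ℝ) : ℂ) * Complex.I))
      (ν.prod (stdGaussianPi (Fin N))) :=
    .of_bound (C := 1) (Measurable.aestronglyMeasurable
      (Complex.measurable_exp.comp ((Complex.measurable_ofReal.comp
        (Finset.measurable_sum _ fun c _ => (h' c).const_mul _)).mul_const _)))
      (ae_of_all _ fun q => (Complex.norm_exp_ofReal_mul_I _).le)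
  rw [integral_prod _ hi, gaussianMixture, ← integral_complex_ofReal]
  refine integral_congr_ae (ae_of_all _ fun ω => ?_)
  have h : ∀ ξ, ∑ j, x j * (D ω).mulVec ξ j = ∑ k, ξ k * Matrix.vecMul x (D ω) k := by
    intro ξ
    have := Matrix.dotProduct_mulVec x (D ω) ξ
    rw [dotProduct_comm (Matrix.vecMul x (D ω))] at this
    exact this
  simp only [h]
  exact (integral_cexp_stdGaussianPi _).symm

variable {θ φ : Fin n → ℝ} {ιθ ιφ : (Fin d → ℝ) →ₗ[ℝ] (Fin n × Fin m → ℝ)}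

/-- The comparison inequality for products of mixtures of Gaussians. -/
lemma gaussianMixture_comparison [IsFiniteMeasure ν] (hν : ν ≠ 0)
    (hD : ∀ j k, Measurable fun ω => D ω j k)
    (hθ : ∑ i, θ i ^ 2 = 1) (hφ : ∑ i, φ i ^ 2 = 1)
    (hmaj : IsMajorizedBy (fun i => θ i ^ 2) (fun i => φ i ^ 2))
    (hιθ : IsEuclParam m n d ιθ (blockHyp m n θ)) (hιφ : IsEuclParam m n d ιφ (blockHyp m n φ)) :
    ∫ y, ∏ i, gaussianMixture ν D (fun j => ιθ y (i, j)) ∂stdGaussianPi (Fin d) ≤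
      ∫ y, ∏ i, gaussianMixture ν D (fun j => ιφ y (i, j)) ∂stdGaussianPi (Fin d) := by
  have hV := measurable_mulVec hD
  have hf := gaussianMixture_eq_integral_cexp (ν := ν) hD
  obtain ⟨h1, e1⟩ := hιθ.integral_prod_eq hθ _ hV hf
  obtain ⟨h2, e2⟩ := hιφ.integral_prod_eq hφ _ hV hf
  rw [e1, e2]
  refine integral_mono h1 h2 fun z => ?_
  obtain ⟨h, hconv, hh⟩ := exists_convexOn_sectionTransform hν hD z
  simp only [hh, ← Real.exp_sum]
  exact Real.exp_le_exp.2 (hmaj.sum_convex_le hconv)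

end Mixture

section Approximation

variable {m n d : ℕ} {ιθ ιφ : (Fin d → ℝ) →ₗ[ℝ] (Fin n × Fin m → ℝ)}

/-- Comparison of the Gaussian integrals of `∏ i, f (x i)` over the ranges of `ιθ` and `ιφ`. -/
def SectionLE (ιθ ιφ : (Fin d → ℝ) →ₗ[ℝ] (Fin n × Fin m → ℝ)) (f : (Fin m → ℝ) → ℝ) : Prop :=
  ∫ y, ∏ i, f (fun j => ιθ y (i, j)) ∂stdGaussianPi (Fin d) ≤
    ∫ y, ∏ i, f (fun j => ιφ y (i, j)) ∂stdGaussianPi (Fin d)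

lemma SectionLE.const_mul {f : (Fin m → ℝ) → ℝ} (hf : SectionLE ιθ ιφ f) {C : ℝ} (hC : 0 ≤ C) :
    SectionLE ιθ ιφ fun x => C * f x := by
  simp only [SectionLE, Finset.prod_mul_distrib, integral_const_mul]
  exact mul_le_mul_of_nonneg_left hf (by positivity)

lemma tendsto_integral_section (ι : (Fin d → ℝ) →ₗ[ℝ] (Fin n × Fin m → ℝ))
    {f : (Fin m → ℝ) → ℝ} {F : ℕ → (Fin m → ℝ) → ℝ} (hFm : ∀ k, Measurable (F k))
    (hF0 : ∀ k x, 0 ≤ F k x) (hF1 : ∀ k x, F k x ≤ 1)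
    (hlim : ∀ x, Tendsto (fun k => F k x) atTop (nhds (f x))) :
    Tendsto (fun k => ∫ y, ∏ i, F k (fun j => ι y (i, j)) ∂stdGaussianPi (Fin d)) atTop
      (nhds (∫ y, ∏ i, f (fun j => ι y (i, j)) ∂stdGaussianPi (Fin d))) := by
  have hι : ∀ c, Measurable fun y => ι y c := fun c =>
    ((continuous_apply c).comp ι.continuous_of_finiteDimensional).measurable
  refine tendsto_integral_of_dominated_convergence (fun _ => 1) (fun k => ?_) (integrable_const _)
    (fun k => ae_of_all _ fun y => ?_)
    (ae_of_all _ fun y => tendsto_finsetProd _ fun i _ => hlim _)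
  · refine (Finset.measurable_prod _ fun i _ => (hFm k).comp ?_).aestronglyMeasurable
    exact measurable_pi_iff.2 fun j => hι (i, j)
  · rw [Real.norm_of_nonneg (Finset.prod_nonneg fun i _ => hF0 _ _)]
    exact Finset.prod_le_one (fun i _ => hF0 _ _) fun i _ => hF1 _ _

lemma SectionLE.of_tendsto {f : (Fin m → ℝ) → ℝ} {F : ℕ → (Fin m → ℝ) → ℝ}
    (h : ∀ k, SectionLE ιθ ιφ (F k)) (hFm : ∀ k, Measurable (F k))
    (hF0 : ∀ k x, 0 ≤ F k x) (hF1 : ∀ k x, F k x ≤ 1)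
    (hlim : ∀ x, Tendsto (fun k => F k x) atTop (nhds (f x))) : SectionLE ιθ ιφ f :=
  le_of_tendsto_of_tendsto' (tendsto_integral_section ιθ hFm hF0 hF1 hlim)
    (tendsto_integral_section ιφ hFm hF0 hF1 hlim) h

lemma measurable_exp_dotProduct_sq :
    Measurable fun q : (Fin m → ℝ) × (Fin m → ℝ) => Real.exp (-(∑ j, q.1 j * q.2 j) ^ 2 / 2) := by
  fun_prop

lemma exp_neg_sq_div_two_le_one (t : ℝ) : Real.exp (-t ^ 2 / 2) ≤ 1 :=
  Real.exp_le_one_iff.2 (by have := sq_nonneg t; linarith)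

lemma integrable_exp_dotProduct_sq (κ : Measure (Fin m → ℝ)) [IsFiniteMeasure κ]
    (x : Fin m → ℝ) : Integrable (fun b => Real.exp (-(∑ j, x j * b j) ^ 2 / 2)) κ :=
  .of_bound (C := 1) (measurable_exp_dotProduct_sq.comp measurable_prodMk_left).aestronglyMeasurable
    (ae_of_all _ fun b => by
      rw [Real.norm_of_nonneg (Real.exp_nonneg _)]
      exact exp_neg_sq_div_two_le_one _)

variable {θ φ : Fin n → ℝ}

lemma sectionLE_pow (hθ : ∑ i, θ i ^ 2 = 1) (hφ : ∑ i, φ i ^ 2 = 1)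
    (hmaj : IsMajorizedBy (fun i => θ i ^ 2) (fun i => φ i ^ 2))
    (hιθ : IsEuclParam m n d ιθ (blockHyp m n θ)) (hιφ : IsEuclParam m n d ιφ (blockHyp m n φ))
    (κ : Measure (Fin m → ℝ)) [IsFiniteMeasure κ] (hκ : κ ≠ 0) (N : ℕ) :
    SectionLE ιθ ιφ fun x => (∫ b, Real.exp (-(∑ j, x j * b j) ^ 2 / 2) ∂κ) ^ N := by
  have h0 : Measure.pi (fun _ : Fin N => κ) ≠ 0 := by
    rw [← Measure.measure_univ_ne_zero, Measure.pi_univ]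
    exact Finset.prod_ne_zero_iff.2 fun _ _ => Measure.measure_univ_ne_zero.2 hκ
  have h := gaussianMixture_comparison h0
    (D := fun ω : Fin N → Fin m → ℝ => Matrix.of fun j k => ω k j)
    (fun j k => (measurable_pi_apply j).comp (measurable_pi_apply k)) hθ hφ hmaj hιθ hιφ
  have e : ∀ x, gaussianMixture (Measure.pi fun _ : Fin N => κ)
      (fun ω : Fin N → Fin m → ℝ => Matrix.of fun j k => ω k j) x =
      (∫ b, Real.exp (-(∑ j, x j * b j) ^ 2 / 2) ∂κ) ^ N := by
    intro x
    have := integral_fintype_prod_eq_pow (ι := Fin N) (μ := κ)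
      (fun b : Fin m → ℝ => Real.exp (-(∑ j, x j * b j) ^ 2 / 2))
    rw [Fintype.card_fin] at this
    rw [← this, gaussianMixture]
    congr 1 with ω
    rw [← Real.exp_sum, ← Finset.sum_div, Finset.sum_neg_distrib]
    rfl
  simpa only [e, SectionLE] using h

lemma sectionLE_exp (hθ : ∑ i, θ i ^ 2 = 1) (hφ : ∑ i, φ i ^ 2 = 1)
    (hmaj : IsMajorizedBy (fun i => θ i ^ 2) (fun i => φ i ^ 2))
    (hιθ : IsEuclParam m n d ιθ (blockHyp m n θ)) (hιφ : IsEuclParam m n d ιφ (blockHyp m n φ))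
    (κ : Measure (Fin m → ℝ)) [IsFiniteMeasure κ] :
    SectionLE ιθ ιφ fun x => Real.exp (-∫ b, (1 - Real.exp (-(∑ j, x j * b j) ^ 2 / 2)) ∂κ) := by
  set g : (Fin m → ℝ) → ℝ := fun x => ∫ b, Real.exp (-(∑ j, x j * b j) ^ 2 / 2) ∂κ with hg
  have hgm : Measurable g :=
    measurable_exp_dotProduct_sq.stronglyMeasurable.integral_prod_right'.measurable
  have hg0 : ∀ x, 0 ≤ g x := fun x => integral_nonneg fun _ => Real.exp_nonneg _
  have hgc : ∀ x, g x ≤ κ.real Set.univ := fun x => by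
    refine (integral_mono (integrable_exp_dotProduct_sq κ x) (integrable_const 1)
      fun b => exp_neg_sq_div_two_le_one _).trans ?_
    simp
  have e : ∀ x, -∫ b, (1 - Real.exp (-(∑ j, x j * b j) ^ 2 / 2)) ∂κ =
      -κ.real Set.univ + g x := fun x => by
    rw [integral_sub (integrable_const _) (integrable_exp_dotProduct_sq κ x)]
    simp only [integral_const, smul_eq_mul, mul_one, hg]
    ring
  simp only [e, Real.exp_add]
  refine SectionLE.of_tendsto
    (F := fun k x => Real.exp (-κ.real Set.univ) * (1 + g x / (k + 1 : ℕ)) ^ (k + 1))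
    (fun k => ?_) (fun k => by fun_prop) (fun k x => ?_) (fun k x => ?_) (fun x => ?_)
  · refine SectionLE.const_mul ?_ (Real.exp_nonneg _)
    set κ' : Measure (Fin m → ℝ) := Measure.dirac 0 + (k + 1 : NNReal)⁻¹ • κ
    have hκ' : κ' ≠ 0 := by
      rw [← Measure.measure_univ_ne_zero]
      simp [κ']
    convert sectionLE_pow hθ hφ hmaj hιθ hιφ κ' hκ' (k + 1) using 3 with x
    rw [integral_add_measure (integrable_exp_dotProduct_sq _ x)
      (integrable_exp_dotProduct_sq _ x), integral_smul_nnreal_measure]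
    simp [hg, NNReal.smul_def, div_eq_inv_mul]
  · have := hg0 x
    positivity
  · have h1 : (1 + g x / (k + 1 : ℕ)) ^ (k + 1) ≤ Real.exp (g x) := by
      have h0 := hg0 x
      calc (1 + g x / (k + 1 : ℕ)) ^ (k + 1) ≤ Real.exp (g x / (k + 1 : ℕ)) ^ (k + 1) := by
            gcongr
            rw [add_comm]
            exact Real.add_one_le_exp _
        _ = Real.exp (g x) := by
            rw [← Real.exp_nat_mul]
            congr 1
            field_simp
    calc _ ≤ Real.exp (-κ.real Set.univ) * Real.exp (g x) := by gcongr
      _ ≤ 1 := by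
        rw [← Real.exp_add, Real.exp_le_one_iff]
        linarith [hgc x]
  · exact ((Real.tendsto_one_add_div_pow_exp (g x)).comp (tendsto_add_atTop_nat 1)).const_mul _

end Approximation

section StableIntegral

variable {p : ℝ}

/-- The integrand of the integral representation of `|s| ^ p`. -/
def stableIntegrand (p s a : ℝ) : ℝ := a ^ (-1 - p) * (1 - Real.exp (-(s * a) ^ 2 / 2))

lemma stableIntegrand_nonneg (s : ℝ) {a : ℝ} (ha : 0 < a) : 0 ≤ stableIntegrand p s a :=
  mul_nonneg (Real.rpow_nonneg ha.le _) (sub_nonneg.2 (exp_neg_sq_div_two_le_one _))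

lemma measurable_stableIntegrand (s : ℝ) : Measurable (stableIntegrand p s) := by
  unfold stableIntegrand
  fun_prop

lemma integrableOn_stableIntegrand_one (hp0 : 0 < p) (hp2 : p < 2) :
    IntegrableOn (stableIntegrand p 1) (Set.Ioi 0) := by
  rw [← Set.Ioc_union_Ioi_eq_Ioi zero_le_one]
  refine IntegrableOn.union ?_ ?_
  · have h : IntegrableOn (fun a : ℝ => a ^ (1 - p)) (Set.Ioc 0 1) := by
      rw [← intervalIntegrable_iff_integrableOn_Ioc_of_le zero_le_one]
      exact intervalIntegral.intervalIntegrable_rpow' (by linarith)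
    refine Integrable.mono' h (measurable_stableIntegrand 1).aestronglyMeasurable
      ((ae_restrict_iff' measurableSet_Ioc).2 (ae_of_all _ fun a ha => ?_))
    rw [Real.norm_of_nonneg (stableIntegrand_nonneg _ ha.1)]
    have h1 : 1 - Real.exp (-(1 * a) ^ 2 / 2) ≤ a ^ 2 := by
      have := Real.add_one_le_exp (-(1 * a) ^ 2 / 2)
      nlinarith [sq_nonneg a]
    calc stableIntegrand p 1 a ≤ a ^ (-1 - p) * a ^ 2 :=
          mul_le_mul_of_nonneg_left h1 (Real.rpow_nonneg ha.1.le _)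
      _ = a ^ (1 - p) := by
          rw [← Real.rpow_natCast, ← Real.rpow_add ha.1]
          congr 1
          push_cast
          ring
  · refine Integrable.mono' (integrableOn_Ioi_rpow_of_lt (a := -1 - p) (by linarith) one_pos)
      (measurable_stableIntegrand 1).aestronglyMeasurable
      ((ae_restrict_iff' measurableSet_Ioi).2 (ae_of_all _ fun a ha => ?_))
    have ha0 : 0 < a := one_pos.trans ha
    rw [Real.norm_of_nonneg (stableIntegrand_nonneg _ ha0)]
    refine mul_le_of_le_one_right (Real.rpow_nonneg ha0.le _) ?_
    linarith [Real.exp_pos (-(1 * a) ^ 2 / 2)]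

lemma stableIntegrand_eq {s a : ℝ} (hs : s ≠ 0) (ha : 0 < a) :
    stableIntegrand p s a = |s| ^ (1 + p) * stableIntegrand p 1 (|s| * a) := by
  have hs' := abs_pos.2 hs
  simp only [stableIntegrand, one_mul, mul_pow, sq_abs]
  rw [Real.mul_rpow hs'.le ha.le, ← mul_assoc, ← mul_assoc, ← Real.rpow_add hs']
  simp

/-- The constant in the integral representation of `|s| ^ p`. -/
def stableConst (p : ℝ) : ℝ := ∫ a in Set.Ioi 0, stableIntegrand p 1 a

lemma stableConst_pos (hp0 : 0 < p) (hp2 : p < 2) : 0 < stableConst p := by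
  refine (setIntegral_pos_iff_support_of_nonneg_ae ?_ (integrableOn_stableIntegrand_one hp0 hp2)).2 ?_
  · exact (ae_restrict_iff' measurableSet_Ioi).2 (ae_of_all _ fun a ha => stableIntegrand_nonneg 1 ha)
  · have : Set.Ioi (0 : ℝ) ⊆ Function.support (stableIntegrand p 1) ∩ Set.Ioi 0 := by
      intro a ha
      have ha : 0 < a := ha
      refine ⟨?_, ha⟩
      refine (mul_pos (Real.rpow_pos_of_pos ha _) (sub_pos.2 (Real.exp_lt_one_iff.2 ?_))).ne'
      have : 0 < (1 * a) ^ 2 := by positivity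
      linarith
    refine lt_of_lt_of_le ?_ (measure_mono this)
    simp

lemma integrableOn_stableIntegrand (hp0 : 0 < p) (hp2 : p < 2) (s : ℝ) :
    IntegrableOn (stableIntegrand p s) (Set.Ioi 0) := by
  rcases eq_or_ne s 0 with rfl | hs
  · have : stableIntegrand p 0 = fun _ => 0 := by
      ext a
      simp [stableIntegrand]
    rw [this]
    exact integrableOn_zero
  refine IntegrableOn.congr_fun ?_ (fun a ha => (stableIntegrand_eq hs ha).symm) measurableSet_Ioi
  refine Integrable.const_mul ?_ _
  refine (integrableOn_Ioi_comp_mul_left_iff _ 0 (abs_pos.2 hs)).2 ?_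
  rw [mul_zero]
  exact integrableOn_stableIntegrand_one hp0 hp2

lemma integral_stableIntegrand (hp0 : 0 < p) (s : ℝ) :
    ∫ a in Set.Ioi 0, stableIntegrand p s a = stableConst p * |s| ^ p := by
  rcases eq_or_ne s 0 with rfl | hs
  · simp [stableIntegrand, Real.zero_rpow hp0.ne']
  have hs' := abs_pos.2 hs
  rw [setIntegral_congr_fun measurableSet_Ioi fun a ha => stableIntegrand_eq hs ha,
    integral_const_mul, integral_comp_mul_left_Ioi _ _ hs', mul_zero, smul_eq_mul, ← mul_assoc,
    Real.rpow_add hs', Real.rpow_one, mul_comm |s|, mul_inv_cancel_right₀ hs'.ne', mul_comm]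
  rfl

/-- Truncations of the integral representation of `|s| ^ p`. -/
def truncatedStable (p : ℝ) (k : ℕ) (s : ℝ) : ℝ :=
  ∫ a in Set.Ioi ((1 : ℝ) / (k + 1)), stableIntegrand p s a

lemma Ioi_one_div_subset (k : ℕ) : Set.Ioi ((1 : ℝ) / (k + 1)) ⊆ Set.Ioi 0 :=
  Set.Ioi_subset_Ioi (by positivity)

lemma truncatedStable_nonneg (k : ℕ) (s : ℝ) : 0 ≤ truncatedStable p k s :=
  setIntegral_nonneg measurableSet_Ioi fun _ ha =>
    stableIntegrand_nonneg _ (Ioi_one_div_subset k ha)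

lemma truncatedStable_le (hp0 : 0 < p) (hp2 : p < 2) (k : ℕ) (s : ℝ) :
    truncatedStable p k s ≤ stableConst p * |s| ^ p := by
  rw [← integral_stableIntegrand hp0]
  exact setIntegral_mono_set (integrableOn_stableIntegrand hp0 hp2 s)
    ((ae_restrict_iff' measurableSet_Ioi).2 (ae_of_all _ fun a ha => stableIntegrand_nonneg s ha))
    (ae_of_all _ (Ioi_one_div_subset k))

lemma tendsto_truncatedStable (hp0 : 0 < p) (hp2 : p < 2) (s : ℝ) :
    Tendsto (fun k => truncatedStable p k s) atTop (nhds (stableConst p * |s| ^ p)) := by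
  have hU : ⋃ k : ℕ, Set.Ioi ((1 : ℝ) / (k + 1)) = Set.Ioi 0 := by
    refine Set.Subset.antisymm (Set.iUnion_subset Ioi_one_div_subset) fun a ha => ?_
    have ha : 0 < a := ha
    obtain ⟨k, hk⟩ := exists_nat_one_div_lt ha
    exact Set.mem_iUnion.2 ⟨k, hk⟩
  rw [← integral_stableIntegrand hp0, ← hU]
  refine tendsto_setIntegral_of_monotone (fun _ => measurableSet_Ioi) ?_
    (by rw [hU]; exact integrableOn_stableIntegrand hp0 hp2 s)
  exact fun i j hij => Set.Ioi_subset_Ioi (Nat.one_div_le_one_div hij)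

/-- The truncated stable Lévy measure. -/
def truncatedMeasure (p : ℝ) (k : ℕ) : Measure ℝ :=
  (volume.restrict (Set.Ioi ((1 : ℝ) / (k + 1)))).withDensity fun a => ENNReal.ofReal (a ^ (-1 - p))

lemma isFiniteMeasure_truncatedMeasure (hp0 : 0 < p) (k : ℕ) :
    IsFiniteMeasure (truncatedMeasure p k) :=
  isFiniteMeasure_withDensity_ofReal
    (integrableOn_Ioi_rpow_of_lt (a := -1 - p) (by linarith) (by positivity)).2

lemma integral_truncatedMeasure (k : ℕ) (s : ℝ) :
    ∫ a, (1 - Real.exp (-(s * a) ^ 2 / 2)) ∂truncatedMeasure p k = truncatedStable p k s := by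
  rw [truncatedMeasure, integral_withDensity_eq_integral_toReal_smul (by fun_prop)
    (ae_of_all _ fun _ => ENNReal.ofReal_lt_top)]
  refine setIntegral_congr_fun measurableSet_Ioi fun a ha => ?_
  have ha : 0 < a := Ioi_one_div_subset k ha
  simp only [ENNReal.toReal_ofReal (Real.rpow_nonneg ha.le _), smul_eq_mul, stableIntegrand]

end StableIntegral

section Sphere

variable {m : ℕ} {p : ℝ} {μ : Measure (Metric.sphere (0 : EuclideanSpace ℝ (Fin m)) 1)}

lemma sum_sq_sphere (u : Metric.sphere (0 : EuclideanSpace ℝ (Fin m)) 1) :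
    ∑ k, (u : EuclideanSpace ℝ (Fin m)) k ^ 2 = 1 := by
  rw [← EuclideanSpace.real_norm_sq_eq, norm_eq_of_mem_sphere, one_pow]

lemma measurable_sphere_apply (k : Fin m) :
    Measurable fun u : Metric.sphere (0 : EuclideanSpace ℝ (Fin m)) 1 =>
      (u : EuclideanSpace ℝ (Fin m)) k :=
  ((EuclideanSpace.proj k).continuous.comp continuous_subtype_val).measurable

lemma IsIsotropic.isFiniteMeasure (h : IsIsotropic m μ) : IsFiniteMeasure μ := by
  have hk : ∀ k : Fin m, Integrable (fun u : Metric.sphere (0 : EuclideanSpace ℝ (Fin m)) 1 =>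
      (u : EuclideanSpace ℝ (Fin m)) k ^ 2) μ := by
    intro k
    by_contra hni
    have := h (Pi.single k 1)
    simp only [Pi.single_apply, ite_mul, one_mul, zero_mul, Finset.sum_ite_eq', Finset.mem_univ,
      if_true, ite_pow, one_pow, ne_eq, OfNat.ofNat_ne_zero, not_false_eq_true, zero_pow] at this
    rw [integral_undef hni] at this
    exact one_ne_zero this
  have := integrable_finsetSum Finset.univ fun k _ => hk k
  simp only [sum_sq_sphere] at this
  simpa [integrable_const_iff] using this

lemma abs_sum_mul_sphere_le (x : Fin m → ℝ) (u : Metric.sphere (0 : EuclideanSpace ℝ (Fin m)) 1) :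
    |∑ k, x k * (u : EuclideanSpace ℝ (Fin m)) k| ≤ ∑ k, |x k| := by
  refine (Finset.abs_sum_le_sum_abs _ _).trans (Finset.sum_le_sum fun k _ => ?_)
  rw [abs_mul]
  refine mul_le_of_le_one_right (abs_nonneg _) ?_
  have := PiLp.norm_apply_le (u : EuclideanSpace ℝ (Fin m)) k
  rwa [norm_eq_of_mem_sphere, Real.norm_eq_abs] at this

lemma lewisNorm_rpow (hp0 : 0 < p) (x : Fin m → ℝ) :
    lewisNorm m p μ x ^ p = ∫ u, |∑ k, x k * (u : EuclideanSpace ℝ (Fin m)) k| ^ p ∂μ := by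
  rw [lewisNorm, ← Real.rpow_mul (integral_nonneg fun _ => Real.rpow_nonneg (abs_nonneg _) _),
    one_div, inv_mul_cancel₀ hp0.ne', Real.rpow_one]

lemma tendsto_integral_truncatedStable [IsFiniteMeasure μ] (hp0 : 0 < p) (hp2 : p < 2)
    (x : Fin m → ℝ) :
    Tendsto (fun k => ∫ u, truncatedStable p k (∑ j, x j * (u : EuclideanSpace ℝ (Fin m)) j) ∂μ)
      atTop (nhds (stableConst p * lewisNorm m p μ x ^ p)) := by
  rw [lewisNorm_rpow hp0, ← integral_const_mul]
  have hK := stableConst_pos hp0 hp2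
  refine tendsto_integral_of_dominated_convergence
    (fun _ => stableConst p * (∑ k, |x k|) ^ p) (fun k => ?_) (integrable_const _)
    (fun k => ae_of_all _ fun u => ?_) (ae_of_all _ fun u => tendsto_truncatedStable hp0 hp2 _)
  · have h1 : Measurable (truncatedStable p k) := by
      have : Measurable fun q : ℝ × ℝ => stableIntegrand p q.1 q.2 := by
        unfold stableIntegrand; fun_prop
      exact (this.stronglyMeasurable.integral_prod_right').measurable
    exact (h1.comp (Finset.measurable_sum _ fun j _ =>
      (measurable_sphere_apply j).const_mul _)).aestronglyMeasurable
  · rw [Real.norm_of_nonneg (truncatedStable_nonneg _ _)]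
    refine (truncatedStable_le hp0 hp2 _ _).trans ?_
    have := abs_sum_mul_sphere_le x u
    gcongr

/-- Finite measures on `ℝ^m` approximating the Lévy measure of `exp (-lam ‖·‖ ^ p)`. -/
def levyMeasure (μ : Measure (Metric.sphere (0 : EuclideanSpace ℝ (Fin m)) 1)) (p C : ℝ) (k : ℕ) :
    Measure (Fin m → ℝ) :=
  (C.toNNReal • μ.prod (truncatedMeasure p k)).map
    fun q j => (q.1 : EuclideanSpace ℝ (Fin m)) j * q.2

lemma isFiniteMeasure_levyMeasure [IsFiniteMeasure μ] (hp0 : 0 < p) (C : ℝ) (k : ℕ) :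
    IsFiniteMeasure (levyMeasure μ p C k) := by
  have := isFiniteMeasure_truncatedMeasure hp0 k
  unfold levyMeasure
  infer_instance

lemma integral_levyMeasure [IsFiniteMeasure μ] (hp0 : 0 < p) {C : ℝ} (hC : 0 ≤ C) (k : ℕ)
    (x : Fin m → ℝ) :
    ∫ b, (1 - Real.exp (-(∑ j, x j * b j) ^ 2 / 2)) ∂levyMeasure μ p C k =
      C * ∫ u, truncatedStable p k (∑ j, x j * (u : EuclideanSpace ℝ (Fin m)) j) ∂μ := by
  have := isFiniteMeasure_truncatedMeasure hp0 k
  have hu : ∀ j, Measurable fun q : Metric.sphere (0 : EuclideanSpace ℝ (Fin m)) 1 × ℝ =>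
      (q.1 : EuclideanSpace ℝ (Fin m)) j := fun j => (measurable_sphere_apply j).comp measurable_fst
  have hm : Measurable fun (q : Metric.sphere (0 : EuclideanSpace ℝ (Fin m)) 1 × ℝ) (j : Fin m) =>
      (q.1 : EuclideanSpace ℝ (Fin m)) j * q.2 :=
    measurable_pi_iff.2 fun j => (hu j).mul measurable_snd
  have hsum : ∀ q : Metric.sphere (0 : EuclideanSpace ℝ (Fin m)) 1 × ℝ,
      ∑ j, x j * ((q.1 : EuclideanSpace ℝ (Fin m)) j * q.2) =
        (∑ j, x j * (q.1 : EuclideanSpace ℝ (Fin m)) j) * q.2 := fun q => by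
    rw [Finset.sum_mul]
    exact Finset.sum_congr rfl fun j _ => by ring
  rw [levyMeasure, integral_map hm.aemeasurable (Measurable.aestronglyMeasurable (by fun_prop)),
    integral_smul_nnreal_measure]
  simp only [hsum]
  have hi : Integrable (fun q : Metric.sphere (0 : EuclideanSpace ℝ (Fin m)) 1 × ℝ =>
      1 - Real.exp (-((∑ j, x j * (q.1 : EuclideanSpace ℝ (Fin m)) j) * q.2) ^ 2 / 2))
      (μ.prod (truncatedMeasure p k)) := by
    refine .of_bound (C := 1) (Measurable.aestronglyMeasurable (by fun_prop))
      (ae_of_all _ fun q => ?_)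
    rw [Real.norm_of_nonneg (sub_nonneg.2 (exp_neg_sq_div_two_le_one _))]
    exact sub_le_self _ (Real.exp_nonneg _)
  rw [integral_prod _ hi]
  simp only [integral_truncatedMeasure, NNReal.smul_def, Real.coe_toNNReal _ hC, smul_eq_mul]

lemma sectionLE_exp_lewisNorm {n d : ℕ} {ιθ ιφ : (Fin d → ℝ) →ₗ[ℝ] (Fin n × Fin m → ℝ)}
    {θ φ : Fin n → ℝ} [IsFiniteMeasure μ] (hp0 : 0 < p) (hp2 : p < 2) {lam : ℝ} (hlam : 0 < lam)
    (hθ : ∑ i, θ i ^ 2 = 1) (hφ : ∑ i, φ i ^ 2 = 1)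
    (hmaj : IsMajorizedBy (fun i => θ i ^ 2) (fun i => φ i ^ 2))
    (hιθ : IsEuclParam m n d ιθ (blockHyp m n θ)) (hιφ : IsEuclParam m n d ιφ (blockHyp m n φ)) :
    SectionLE ιθ ιφ fun x => Real.exp (-(lam * lewisNorm m p μ x ^ p)) := by
  have hK := stableConst_pos hp0 hp2
  have hC : 0 ≤ lam / stableConst p := by positivity
  have hfin := fun k => isFiniteMeasure_levyMeasure (μ := μ) hp0 (lam / stableConst p) k
  refine SectionLE.of_tendsto
    (F := fun k x => Real.exp (-∫ b, (1 - Real.exp (-(∑ j, x j * b j) ^ 2 / 2))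
      ∂levyMeasure μ p (lam / stableConst p) k))
    (fun k => sectionLE_exp hθ hφ hmaj hιθ hιφ _) (fun k => ?_) (fun k x => Real.exp_nonneg _)
    (fun k x => ?_) (fun x => ?_)
  · exact ((measurable_const.sub measurable_exp_dotProduct_sq).stronglyMeasurable
      |>.integral_prod_right' |>.measurable.neg.exp)
  · rw [Real.exp_le_one_iff, neg_nonpos]
    exact integral_nonneg fun b => sub_nonneg.2 (exp_neg_sq_div_two_le_one _)
  · simp only [integral_levyMeasure hp0 hC]
    refine (Real.continuous_exp.tendsto _).comp (Tendsto.neg ?_)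
    have := (tendsto_integral_truncatedStable (μ := μ) hp0 hp2 x).const_mul (lam / stableConst p)
    rwa [← mul_assoc, div_mul_cancel₀ _ hK.ne'] at this

lemma IsIsotropic.lewisNorm_rpow_two (h : IsIsotropic m μ) (x : Fin m → ℝ) :
    lewisNorm m 2 μ x ^ (2 : ℝ) = ∑ k, x k ^ 2 := by
  rw [lewisNorm_rpow two_pos, h x]
  simp

end Sphere

/-- **Theorem (comparison of Laplace transforms).** Let `p ∈ (0,2]`, `μ` an isotropic measure
on `S^{m-1}` and `X = X_p(μ)`, so that `B_X` is in Lewis position. For a unit vector `a` of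
`ℝ^n`, the standard Gaussian random vector `G_a` on `H_a ⊆ ℝ^{mn}` is realized as `ι_a(Y)`,
where `ι_a` is a Euclidean isometric parametrization of `H_a` and `Y` is a standard Gaussian
vector on `ℝ^{m(n-1)}`. If `(θ_1²,…,θ_n²)` is majorized by `(φ_1²,…,φ_n²)` then for every
`λ > 0`, `E exp(−λ‖G_θ‖_{ℓ_p^n(X)}^p) ≤ E exp(−λ‖G_φ‖_{ℓ_p^n(X)}^p)`. -/
theorem laplace_transform_comparison (m n : ℕ) (p : ℝ) (hp0 : 0 < p) (hp2 : p ≤ 2)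
    (μ : Measure (Metric.sphere (0 : EuclideanSpace ℝ (Fin m)) 1)) (hiso : IsIsotropic m μ)
    (lam : ℝ) (hlam : 0 < lam)
    (θ φ : Fin n → ℝ) (hθ : ∑ i, θ i ^ 2 = 1) (hφ : ∑ i, φ i ^ 2 = 1)
    (hmaj : IsMajorizedBy (fun i => θ i ^ 2) (fun i => φ i ^ 2))
    (ιθ ιφ : (Fin (m * (n - 1)) → ℝ) →ₗ[ℝ] (Fin n × Fin m → ℝ))
    (hιθ : IsEuclParam m n (m * (n - 1)) ιθ (blockHyp m n θ))
    (hιφ : IsEuclParam m n (m * (n - 1)) ιφ (blockHyp m n φ)) :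
    ∫ y, Real.exp (-(lam * ∑ i : Fin n, lewisNorm m p μ (fun j => ιθ y (i, j)) ^ p))
        ∂(Measure.pi fun _ : Fin (m * (n - 1)) => ProbabilityTheory.gaussianReal 0 1) ≤
      ∫ y, Real.exp (-(lam * ∑ i : Fin n, lewisNorm m p μ (fun j => ιφ y (i, j)) ^ p))
        ∂(Measure.pi fun _ : Fin (m * (n - 1)) => ProbabilityTheory.gaussianReal 0 1) := by
  rcases hp2.lt_or_eq with hp2 | rfl
  · have := hiso.isFiniteMeasure
    have h := sectionLE_exp_lewisNorm (μ := μ) hp0 hp2 hlam hθ hφ hmaj hιθ hιφ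
    simpa only [SectionLE, ← Real.exp_sum, Finset.sum_neg_distrib, ← Finset.mul_sum] using h
  · have hsum : ∀ x : Fin n × Fin m → ℝ, ∑ i, ∑ k, x (i, k) ^ 2 = ∑ c, x c ^ 2 :=
      fun x => (Fintype.sum_prod_type fun c => x c ^ 2).symm
    simp only [hiso.lewisNorm_rpow_two, hsum, hιθ.1, hιφ.1, le_refl]
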